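/- arXiv:1202.1511 — 2 statements merged into one kernel-verified Lean document; each statement's English description precedes it below -/
import Mathlib

section
/- (Mason–Stothers $abc$ theorem.) If $a$, $b$, $c$ are polynomials over $\mathbb{C}$, not all constant, having no common zeros, and satisfying $a + b = c$, then $\max\{\deg a, \deg b, \deg c\} \le \widetilde N(abc) - 1$. -/
open UniqueFactorizationMonoid in
theorem natDegree_radical_le_card_roots {K : Type*} [Field K] [DecidableEq K] [IsAlgClosed K]
    {p : Polynomial K} (hp : p ≠ 0) :
    (radical p).natDegree ≤ p.roots.toFinset.card := by
  have hnodup : (radical p).roots.Nodup :=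
    Polynomial.nodup_roots (PerfectField.separable_iff_squarefree.mpr squarefree_radical)
  rw [(IsAlgClosed.splits (radical p)).natDegree_eq_card_roots,
    ← Multiset.toFinset_card_of_nodup hnodup]
  exact Finset.card_le_card (Multiset.toFinset_subset.mpr
    (Multiset.subset_of_le (Polynomial.roots.le_of_dvd hp radical_dvd_self)))

theorem natDegree_eq_zero_of_forall_eval_ne_zero {K : Type*} [Field K] [IsAlgClosed K]
    {p : Polynomial K} (hp : ∀ z, p.eval z ≠ 0) : p.natDegree = 0 := by
  by_contra h
  obtain ⟨z, hz⟩ := IsAlgClosed.exists_root p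
    fun hdeg => h (Polynomial.natDegree_eq_of_degree_eq_some hdeg)
  exact hp z hz

/-- **Mason–Stothers `abc` theorem for polynomials.**
If `a`, `b`, `c` are polynomials over `ℂ`, not all constant, having no common zeros,
and satisfying `a + b = c`, then
`max {deg a, deg b, deg c} ≤ Ñ(abc) - 1`, where `Ñ(p)` is the number of distinct
complex zeros of `p`. -/
theorem mason_stothers (a b c : Polynomial ℂ)
    (hnotconst : ¬(a.natDegree = 0 ∧ b.natDegree = 0 ∧ c.natDegree = 0))
    (hnocommon : ∀ z : ℂ, ¬(a.eval z = 0 ∧ b.eval z = 0 ∧ c.eval z = 0))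
    (habc : a + b = c) :
    (max (max a.natDegree b.natDegree) c.natDegree : ℤ)
      ≤ ((a * b * c).roots.toFinset.card : ℤ) - 1 := by
  subst habc
  have ha : a ≠ 0 := by
    rintro rfl
    have := natDegree_eq_zero_of_forall_eval_ne_zero (p := b) (by simpa using hnocommon)
    simp [this] at hnotconst
  have hb : b ≠ 0 := by
    rintro rfl
    have := natDegree_eq_zero_of_forall_eval_ne_zero (p := a) (by simpa using hnocommon)
    simp [this] at hnotconst
  have hc : a + b ≠ 0 := by
    intro h
    obtain rfl := eq_neg_of_add_eq_zero_left h
    have := natDegree_eq_zero_of_forall_eval_ne_zero (p := b) (by simpa using hnocommon)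
    simp [this] at hnotconst
  have hcoprime : IsCoprime a b := by
    rw [Polynomial.isCoprime_iff_aeval_ne_zero_of_isAlgClosed ℂ ℂ]
    intro z
    by_contra! h
    simp only [Polynomial.coe_aeval_eq_eval] at h
    exact hnocommon z ⟨h.1, h.2, by simp [h.1, h.2]⟩
  have hrad := natDegree_radical_le_card_roots (mul_ne_zero (mul_ne_zero ha hb) hc)
  rcases Polynomial.abc ha hb (neg_ne_zero.mpr hc) hcoprime (add_neg_cancel _) with
    h | ⟨hda, hdb, -⟩
  · simp only [mul_neg, UniqueFactorizationDomain.radical_neg, Polynomial.natDegree_neg] at h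
    omega
  · have hda := Polynomial.derivative_eq_zero.mp hda
    have hdb := Polynomial.derivative_eq_zero.mp hdb
    have hdc := Polynomial.natDegree_add_le a b
    omega
end

section
/- (Generalized $abc$ theorem for polynomials.) Let $p_0, \dots, p_n$ be linearly independent polynomials over $\mathbb{C}$ and put $p_{n+1} = p_0 + \dots + p_n$. Assume the zero-sets of $p_0, \dots, p_{n+1}$ are pairwise disjoint. Then $\max\{\deg p_0, \dots, \deg p_{n+1}\} \le n\,\widetilde N(p_0 p_1 \cdots p_{n+1}) - \frac{n(n+1)}{2}$. -/
open Polynomial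

/-- The matrix whose rows list the successive derivatives of the polynomials `f i`. -/
noncomputable def wronskianMatrix {m : ℕ} (f : Fin m → ℂ[X]) : Matrix (Fin m) (Fin m) ℂ[X] :=
  Matrix.of fun i k => derivative^[(k : ℕ)] (f i)

theorem exists_eq_C_mul_of_mul_derivative_eq {f g : ℂ[X]} (hf : f ≠ 0)
    (h : f * derivative g = derivative f * g) : ∃ c : ℂ, g = C c * f := by
  obtain ⟨a, ha⟩ : ∃ a : ℂ, f.eval a ≠ 0 := by
    by_contra! hall
    exact hf (Polynomial.funext (by simpa using hall))
  refine ⟨g.eval a / f.eval a, sub_eq_zero.mp ?_⟩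
  set r := g - C (g.eval a / f.eval a) * f with hr
  by_contra hr0
  have hroot : r.IsRoot a := by
    simp [hr, IsRoot, div_mul_cancel₀ _ ha]
  have hrel : f * derivative r = derivative f * r := by
    simp only [hr, derivative_sub, derivative_mul, derivative_C]
    linear_combination h
  have hpos : 0 < r.rootMultiplicity a := (rootMultiplicity_pos hr0).mpr hroot
  have hdvd : (X - C a) ^ r.rootMultiplicity a ∣ derivative r := by
    refine (IsCoprime.pow_left ?_ :
      IsCoprime ((X - C a) ^ r.rootMultiplicity a) f).dvd_of_dvd_mul_left (hrel ▸
        (pow_rootMultiplicity_dvd r a).mul_left _)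
    exact (irreducible_X_sub_C a).coprime_iff_not_dvd.mpr fun hd => ha (dvd_iff_isRoot.mp hd)
  have hd0 : derivative r ≠ 0 := by
    intro hd0
    have hconst := eq_C_of_natDegree_eq_zero (derivative_eq_zero.mp hd0)
    rw [hconst, IsRoot, eval_C] at hroot
    exact hr0 (by rw [hconst, hroot, C_0])
  have hle := (le_rootMultiplicity_iff hd0).mpr hdvd
  rw [derivative_rootMultiplicity_of_root hroot] at hle
  omega

theorem eq_zero_of_sum_mul_iterate_derivative_eq_zero {m : ℕ} {f : Fin m → ℂ[X]}
    (hf : LinearIndependent ℂ f) {v : Fin m → ℂ[X]}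
    (hv : ∀ k < m, ∑ i, v i * derivative^[k] (f i) = 0) : v = 0 := by
  induction m with
  | zero => exact Subsingleton.elim _ _
  | succ m ih =>
    have hf' : LinearIndependent ℂ (f ∘ Fin.castSucc) :=
      hf.comp _ (Fin.castSucc_injective m)
    by_cases hlast : v (Fin.last m) = 0
    · have hinit : v ∘ Fin.castSucc = 0 := ih hf' fun k hk => by
        simpa [Fin.sum_univ_castSucc, hlast] using hv k (by omega)
      ext1 i
      exact Fin.lastCases hlast (congrFun hinit) i
    · exfalso
      have hderiv : ∀ k < m, ∑ i, derivative (v i) * derivative^[k] (f i) = 0 := fun k hk => by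
        have h := congrArg derivative (hv k (by omega))
        simp only [derivative_sum, derivative_mul, derivative_zero, Finset.sum_add_distrib,
          ← Function.iterate_succ_apply'] at h
        rwa [hv (k + 1) (by omega), add_zero] at h
      have hzero : (fun i : Fin m => v (Fin.last m) * derivative (v i.castSucc) -
          derivative (v (Fin.last m)) * v i.castSucc) = 0 := ih hf' fun k hk => by
        have h₁ := hderiv k hk
        have h₂ := hv k (by omega)
        rw [Fin.sum_univ_castSucc] at h₁ h₂
        simp only [Function.comp_apply, sub_mul, Finset.sum_sub_distrib, mul_assoc,
          ← Finset.mul_sum]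
        linear_combination v (Fin.last m) * h₁ - derivative (v (Fin.last m)) * h₂
      have hprop : ∀ i, ∃ c : ℂ, v i = C c * v (Fin.last m) := fun i =>
        exists_eq_C_mul_of_mul_derivative_eq hlast <| by
          refine Fin.lastCases (mul_comm _ _) (fun i => ?_) i
          exact sub_eq_zero.mp (congrFun hzero i)
      choose c hc using hprop
      have hsum : ∑ i, c i • f i = 0 := by
        have h := hv 0 (by omega)
        refine (mul_eq_zero.mp (?_ : v (Fin.last m) * _ = 0)).resolve_left hlast
        rw [← h, Finset.mul_sum]
        refine Finset.sum_congr rfl fun i _ => ?_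
        rw [hc i, smul_eq_C_mul, Function.iterate_zero_apply]
        ring
      have hc0 := Fintype.linearIndependent_iff.mp hf c hsum (Fin.last m)
      exact hlast (by rw [hc, hc0]; simp)

theorem det_wronskianMatrix_ne_zero {m : ℕ} {f : Fin m → ℂ[X]} (hf : LinearIndependent ℂ f) :
    (wronskianMatrix f).det ≠ 0 := by
  intro h
  obtain ⟨v, hv0, hv⟩ := Matrix.exists_vecMul_eq_zero_iff.mpr h
  exact hv0 <| eq_zero_of_sum_mul_iterate_derivative_eq_zero hf fun k hk => congrFun hv ⟨k, hk⟩

theorem det_wronskianMatrix_dvd_of_mem_span {m : ℕ} {f g : Fin m → ℂ[X]}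
    (h : ∀ i, g i ∈ Submodule.span ℂ (Set.range f)) :
    (wronskianMatrix f).det ∣ (wronskianMatrix g).det := by
  choose c hc using fun i => (Submodule.mem_span_range_iff_exists_fun ℂ).mp (h i)
  have hmul : wronskianMatrix g = Matrix.of (fun i j => C (c i j)) * wronskianMatrix f := by
    ext1 i k
    simp only [wronskianMatrix, Matrix.of_apply, Matrix.mul_apply, ← hc,
      iterate_derivative_sum, smul_eq_C_mul, iterate_derivative_C_mul]
  rw [hmul, Matrix.det_mul]
  exact dvd_mul_left _ _

theorem pow_sub_dvd_det_wronskianMatrix {m n : ℕ} {f : Fin (n + 1) → ℂ[X]} {d : ℂ[X]}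
    (i : Fin (n + 1)) (h : d ^ m ∣ f i) : d ^ (m - n) ∣ (wronskianMatrix f).det := by
  rw [← Matrix.det_transpose, Matrix.det_apply]
  refine Finset.dvd_sum fun σ _ => dvd_smul_of_dvd _ ?_
  refine dvd_trans ?_ (Finset.dvd_prod_of_mem _ (Finset.mem_univ i))
  exact (pow_dvd_pow d (by have := (σ i).isLt; omega)).trans
    (pow_sub_dvd_iterate_derivative_of_pow_dvd _ h)

theorem degree_iterate_derivative_add_le (f : ℂ[X]) (k : ℕ) :
    (derivative^[k] f).degree + k ≤ f.degree := by
  induction k with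
  | zero => simp
  | succ k ih =>
    rw [Function.iterate_succ_apply']
    refine le_trans ?_ ih
    rcases eq_or_ne (derivative^[k] f) 0 with h | h
    · simp [h]
    · rw [Nat.cast_succ, add_comm (k : WithBot ℕ), ← add_assoc]
      gcongr
      exact Nat.WithBot.add_one_le_of_lt (degree_derivative_lt h)

theorem degree_det_wronskianMatrix_add_le {m : ℕ} (f : Fin m → ℂ[X]) :
    (wronskianMatrix f).det.degree + (∑ i : Fin m, (i : ℕ) : ℕ) ≤ ∑ i, (f i).degree := by
  rw [Matrix.det_apply]
  refine Finset.sum_induction _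
    (fun P : ℂ[X] => P.degree + (∑ i : Fin m, (i : ℕ) : ℕ) ≤ ∑ i, (f i).degree) ?_ (by simp) ?_
  · intro a b ha hb
    rcases le_max_iff.mp (degree_add_le a b) with h | h
    · exact (add_le_add_left h _).trans ha
    · exact (add_le_add_left h _).trans hb
  · intro σ _
    have hdeg : ∀ P : ℂ[X], (Equiv.Perm.sign σ • P).degree = P.degree := fun P => by
      rcases Int.units_eq_one_or (Equiv.Perm.sign σ) with h | h <;> simp [h]
    rw [hdeg, degree_prod, Nat.cast_sum, ← Finset.sum_add_distrib,
      ← Equiv.sum_comp σ fun i => (f i).degree]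
    exact Finset.sum_le_sum fun i _ => degree_iterate_derivative_add_le _ _

theorem natDegree_det_wronskianMatrix_add_le {m : ℕ} {f : Fin m → ℂ[X]}
    (h : (wronskianMatrix f).det ≠ 0) (hf : ∀ i, f i ≠ 0) :
    (wronskianMatrix f).det.natDegree + ∑ i : Fin m, (i : ℕ) ≤ ∑ i, (f i).natDegree := by
  have hle := degree_det_wronskianMatrix_add_le f
  simp only [degree_eq_natDegree h, degree_eq_natDegree (hf _)] at hle
  exact_mod_cast hle

theorem natDegree_le_of_rootMultiplicity_le {P W : ℂ[X]} {n : ℕ}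
    (h : ∀ z, P.rootMultiplicity z ≤ W.rootMultiplicity z + n) :
    P.natDegree ≤ W.natDegree + n * P.roots.toFinset.card := by
  classical
  calc P.natDegree = ∑ z ∈ P.roots.toFinset, P.rootMultiplicity z := by
        rw [← IsAlgClosed.card_roots_eq_natDegree, ← Multiset.toFinset_sum_count_eq]
        simp
    _ ≤ ∑ z ∈ P.roots.toFinset, (W.rootMultiplicity z + n) := Finset.sum_le_sum fun z _ => h z
    _ = ∑ z ∈ P.roots.toFinset, W.roots.count z + n * P.roots.toFinset.card := by
        simp [Finset.sum_add_distrib, mul_comm]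
    _ ≤ W.natDegree + n * P.roots.toFinset.card := by
        gcongr
        refine le_trans ?_ (card_roots' W)
        rw [← Multiset.sum_count_eq_card (s := P.roots.toFinset ∪ W.roots.toFinset)
          fun z hz => Finset.mem_union_right _ (Multiset.mem_toFinset.mpr hz)]
        exact Finset.sum_le_sum_of_subset Finset.subset_union_left

/-- **Generalized `abc` theorem for polynomials.**
Let `p 0, …, p n` be linearly independent polynomials over `ℂ` and let
`q (n+1) = p 0 + ⋯ + p n` (where `q` extends `p`).  Assume the zero-sets of
`q 0, …, q (n+1)` are pairwise disjoint.  Then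
`max {deg (q 0), …, deg (q (n+1))} ≤ n * Ñ(q 0 ⋯ q (n+1)) - n (n+1) / 2`,
where `Ñ(p)` is the number of distinct complex zeros of `p`. -/
theorem generalized_abc_polynomials (n : ℕ) (hn : 1 ≤ n)
    (p : Fin (n + 1) → Polynomial ℂ)
    (hli : LinearIndependent ℂ p)
    (q : Fin (n + 2) → Polynomial ℂ)
    (hq : ∀ j : Fin (n + 1), q j.castSucc = p j)
    (hqlast : q (Fin.last (n + 1)) = ∑ j : Fin (n + 1), p j)
    (hdisj : ∀ i j : Fin (n + 2), i ≠ j →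
      ∀ z : ℂ, ¬((q i).eval z = 0 ∧ (q j).eval z = 0)) :
    ∀ j : Fin (n + 2),
      ((q j).natDegree : ℤ)
        ≤ (n : ℤ) * ((∏ i : Fin (n + 2), q i).roots.toFinset.card : ℤ)
            - (n : ℤ) * (n + 1) / 2 := by
  have hp0 : ∀ i, p i ≠ 0 := hli.ne_zero
  have hq0 : ∀ i, q i ≠ 0 := by
    refine Fin.lastCases ?_ fun i => hq i ▸ hp0 i
    rw [hqlast]
    intro h
    simpa using Fintype.linearIndependent_iff.mp hli (fun _ => 1) (by simpa using h) 0
  have hspan : ∀ (j : Fin (n + 2)) (l : Fin (n + 1)), p l ∈ Submodule.span ℂ (Set.range (q ∘ j.succAbove)) := by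
    intro j
    have hmem : ∀ i, i ≠ j → q i ∈ Submodule.span ℂ (Set.range (q ∘ j.succAbove)) := by
      intro i hij
      obtain ⟨k, rfl⟩ := Fin.exists_succAbove_eq hij
      exact Submodule.subset_span ⟨k, rfl⟩
    intro l
    by_cases hl : l.castSucc = j
    · have hpl : p l = q (Fin.last (n + 1)) - ∑ i ∈ Finset.univ.erase l, p i := by
        rw [hqlast, ← Finset.add_sum_erase _ _ (Finset.mem_univ l), add_sub_cancel_right]
      rw [hpl]
      refine Submodule.sub_mem _ (hmem _ (hl ▸ (Fin.castSucc_ne_last l).symm))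
        (Submodule.sum_mem _ fun i hi => hq i ▸ hmem _ ?_)
      rw [← hl]
      exact fun h => Finset.ne_of_mem_erase hi (Fin.castSucc_injective _ h)
    · exact hq l ▸ hmem _ hl
  have hspan' : ∀ i, q i ∈ Submodule.span ℂ (Set.range p) := by
    refine Fin.lastCases ?_ fun i => hq i ▸ Submodule.subset_span ⟨i, rfl⟩
    rw [hqlast]
    exact Submodule.sum_mem _ fun i _ => Submodule.subset_span ⟨i, rfl⟩
  set W := (wronskianMatrix p).det
  have hW0 : W ≠ 0 := det_wronskianMatrix_ne_zero hli
  have hdvd : ∀ j : Fin (n + 2), (wronskianMatrix (q ∘ j.succAbove)).det ∣ W := fun j =>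
    det_wronskianMatrix_dvd_of_mem_span (hspan j)
  have hmult : ∀ z, (∏ i, q i).rootMultiplicity z ≤ W.rootMultiplicity z + n := by
    intro z
    have hsum : (∏ i, q i).rootMultiplicity z = ∑ i, (q i).rootMultiplicity z := by
      simp only [← count_roots]
      rw [roots_prod _ _ (Finset.prod_ne_zero_iff.mpr fun i _ => hq0 i), Multiset.count_bind]
      rfl
    by_cases hz : ∃ i, (q i).eval z = 0
    · obtain ⟨i, hi⟩ := hz
      rw [hsum, Finset.sum_eq_single i (fun j _ hji => rootMultiplicity_eq_zero
        fun hj => hdisj i j hji.symm z ⟨hi, hj⟩) (by simp), ← Nat.sub_le_iff_le_add,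
        le_rootMultiplicity_iff hW0]
      obtain ⟨j, hj⟩ := exists_ne i
      obtain ⟨k, rfl⟩ := Fin.exists_succAbove_eq hj.symm
      exact (pow_sub_dvd_det_wronskianMatrix (f := q ∘ j.succAbove) k
        (pow_rootMultiplicity_dvd _ z)).trans (hdvd j)
    · push Not at hz
      rw [hsum, Finset.sum_eq_zero fun i _ => rootMultiplicity_eq_zero (hz i)]
      exact Nat.zero_le _
  intro j
  have hupper := natDegree_le_of_rootMultiplicity_le hmult
  rw [natDegree_prod _ _ fun i _ => hq0 i, Fin.sum_univ_succAbove _ j] at hupper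
  have hj0 : (wronskianMatrix (q ∘ j.succAbove)).det ≠ 0 := ne_zero_of_dvd_ne_zero hW0 (hdvd j)
  have hlower := natDegree_det_wronskianMatrix_add_le hj0 fun i => hq0 _
  have hWle : W.natDegree ≤ (wronskianMatrix (q ∘ j.succAbove)).det.natDegree :=
    natDegree_le_of_dvd (det_wronskianMatrix_dvd_of_mem_span fun i => hspan' _) hj0
  have hgauss : (∑ i : Fin (n + 1), (i : ℕ)) * 2 = (n + 1) * n := by
    rw [Fin.sum_univ_eq_sum_range fun i => i]
    exact Finset.sum_range_id_mul_two (n + 1)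
  have hhalf : (n : ℤ) * (n + 1) / 2 = (∑ i : Fin (n + 1), (i : ℕ) : ℕ) :=
    Int.ediv_eq_of_eq_mul_left two_ne_zero (by rw [mul_comm]; exact_mod_cast hgauss.symm)
  rw [hhalf]
  simp only [Function.comp_apply] at hlower
  zify at hupper hlower hWle
  push_cast
  linarith
end
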